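/- Suppose ψ : E_A → ℝ is locally Hölder continuous. For a finite subset F ⊆ E let F_A := {ω ∈ F^ℤ : A_{ω_n ω_{n+1}} = 1 for all n ∈ ℤ} and let P_F(ψ) denote the topological pressure of the restriction ψ|_{F_A} with respect to the shift σ : F_A → F_A (with P_F(ψ) := −∞ if F_A = ∅). Then P(ψ) = sup{P_F(ψ) : F ⊆ E finite}, and this supremum is also attained when taken only over finite subsets F ⊆ E such that the matrix A|_{F×F} is irreducible. -/

import Mathlib

open MeasureTheory Filter Set Topology

open scoped ENNReal Classical

namespace Paper

variable {E : Type*}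

/-- Two-sided shift space over alphabet `E` with incidence matrix `A`. -/
abbrev EA (A : E → E → Bool) : Type _ :=
  {ω : ℤ → E // ∀ n : ℤ, A (ω n) (ω (n + 1)) = true}

/-- One-sided shift space over alphabet `E` with incidence matrix `A`. -/
abbrev EAplus (A : E → E → Bool) : Type _ :=
  {ω : ℕ → E // ∀ n : ℕ, A (ω n) (ω (n + 1)) = true}

/-- A finite word is `A`-admissible if consecutive letters are linked by `A`. -/
def IsAdmissibleList (A : E → E → Bool) : List E → Prop :=
  List.Chain' (fun c d => A c d = true)

/-- The incidence matrix `A` is finitely irreducible. -/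
def FinitelyIrreducible (A : E → E → Bool) : Prop :=
  ∃ Λ : Finset (List E), (∀ γ ∈ Λ, IsAdmissibleList A γ) ∧
    ∀ a b : E, ∃ γ ∈ Λ, IsAdmissibleList A (a :: (γ ++ [b]))

/-- The incidence matrix `A` is irreducible. -/
def IrreducibleMat (A : E → E → Bool) : Prop :=
  ∀ a b : E, ∃ w : List E, IsAdmissibleList A (a :: (w ++ [b]))

variable {A : E → E → Bool}

/-- The two-sided shift map. -/
def shift (A : E → E → Bool) (ω : EA A) : EA A :=
  ⟨fun n => ω.1 (n + 1), fun n => ω.2 (n + 1)⟩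

/-- The one-sided shift map. -/
def shiftPlus (A : E → E → Bool) (ω : EAplus A) : EAplus A :=
  ⟨fun n => ω.1 (n + 1), fun n => ω.2 (n + 1)⟩

/-- Canonical projection from the two-sided to the one-sided shift space:
`π₁(τ) = τ|₀^{+∞}`. -/
def proj1 (A : E → E → Bool) (τ : EA A) : EAplus A :=
  ⟨fun n => τ.1 (n : ℤ), fun n => by simpa using τ.2 (n : ℤ)⟩

/-- `ω` and `τ` agree on all coordinates `k` with `|k| ≤ n`. -/
def agreeTwo (ω τ : EA A) (n : ℕ) : Prop :=
  ∀ k : ℤ, |k| ≤ (n : ℤ) → ω.1 k = τ.1 k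

/-- `ω` and `τ` agree on all coordinates `0 ≤ k ≤ n`. -/
def agreePlus (ω τ : EAplus A) (n : ℕ) : Prop :=
  ∀ k : ℕ, k ≤ n → ω.1 k = τ.1 k

/-- The metric `d_β` on the two-sided shift space:
`d_β(ω,τ) = exp (-β * max{n ≥ -1 : ω and τ agree up to n})`. -/
noncomputable def dist2 (A : E → E → Bool) (β : ℝ) (ω τ : EA A) : ℝ :=
  ⨅ n : ℕ, if agreeTwo ω τ n then Real.exp (-β * n) else Real.exp β

/-- The metric `d_β` on the one-sided shift space. -/
noncomputable def dist1 (A : E → E → Bool) (β : ℝ) (ω τ : EAplus A) : ℝ :=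
  ⨅ n : ℕ, if agreePlus ω τ n then Real.exp (-β * n) else Real.exp β

/-- `ψ` is locally Hölder continuous with exponent `β` and constant `C`. -/
def LocHolderTwo (A : E → E → Bool) (β C : ℝ) (ψ : EA A → ℝ) : Prop :=
  ∀ ω τ : EA A, ω.1 0 = τ.1 0 → ∀ n : ℕ, agreeTwo ω τ n →
    |ψ ω - ψ τ| ≤ C * Real.exp (-β * n)

/-- `ψ` is locally Hölder continuous (for some exponent and constant). -/
def LocallyHolderTwo (A : E → E → Bool) (ψ : EA A → ℝ) : Prop :=
  ∃ β C : ℝ, 0 < β ∧ 0 < C ∧ LocHolderTwo A β C ψ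

/-- One-sided local Hölder continuity with given exponent and constant. -/
def LocHolderPlus (A : E → E → Bool) (β C : ℝ) (ψ : EAplus A → ℝ) : Prop :=
  ∀ ω τ : EAplus A, ω.1 0 = τ.1 0 → ∀ n : ℕ, agreePlus ω τ n →
    |ψ ω - ψ τ| ≤ C * Real.exp (-β * n)

def LocallyHolderPlus (A : E → E → Bool) (ψ : EAplus A → ℝ) : Prop :=
  ∃ β C : ℝ, 0 < β ∧ 0 < C ∧ LocHolderPlus A β C ψ

/-- Birkhoff sum `S_n ψ` for the two-sided shift. -/
noncomputable def birk (A : E → E → Bool) (ψ : EA A → ℝ) (n : ℕ) (ω : EA A) : ℝ :=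
  ∑ j ∈ Finset.range n, ψ ((shift A)^[j] ω)

/-- Birkhoff sum `S_n ψ` for the one-sided shift. -/
noncomputable def birkPlus (A : E → E → Bool) (ψ : EAplus A → ℝ) (n : ℕ) (ω : EAplus A) : ℝ :=
  ∑ j ∈ Finset.range n, ψ ((shiftPlus A)^[j] ω)

/-- The cylinder in `EA A` fixing coordinates `0,…,|w|-1` to the word `w`. -/
def cylList (A : E → E → Bool) (w : List E) : Set (EA A) :=
  {τ | ∀ k : Fin w.length, τ.1 ((k : ℕ) : ℤ) = w.get k}

/-- The cylinder in `EAplus A` fixing coordinates `0,…,|w|-1` to the word `w`. -/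
def cylListPlus (A : E → E → Bool) (w : List E) : Set (EAplus A) :=
  {τ | ∀ k : Fin w.length, τ.1 (k : ℕ) = w.get k}

/-- Logarithm `ℝ≥0∞ → EReal`, with `log 0 = ⊥` and `log ⊤ = ⊤`. -/
noncomputable def elog (x : ℝ≥0∞) : EReal :=
  if x = 0 then ⊥ else if x = ⊤ then ⊤ else ((Real.log x.toReal : ℝ) : EReal)

/-- Partition function `Σ_{|w|=n, w admissible} exp (sup S_nψ|_{[w]})`
(in `ℝ≥0∞`; the supremum of `exp ∘ S_nψ` over the cylinder equals
`exp (sup S_nψ)`, with the empty supremum equal to `0 = e^{-∞}`). -/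
noncomputable def partFn (A : E → E → Bool) (ψ : EA A → ℝ) (n : ℕ) : ℝ≥0∞ :=
  ∑' w : {w : List E // w.length = n ∧ IsAdmissibleList A w},
    ⨆ τ : cylList A w.1, ENNReal.ofReal (Real.exp (birk A ψ n τ.1))

/-- Topological pressure of `ψ` on the two-sided shift space: the limit (here:
`limsup`, the limit exists by subadditivity) of `(1/n) log` of partition functions. -/
noncomputable def pressure (A : E → E → Bool) (ψ : EA A → ℝ) : EReal :=
  Filter.limsup (fun n : ℕ => (((n : ℝ)⁻¹ : ℝ) : EReal) * elog (partFn A ψ n)) Filter.atTop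

noncomputable def partFnPlus (A : E → E → Bool) (ψ : EAplus A → ℝ) (n : ℕ) : ℝ≥0∞ :=
  ∑' w : {w : List E // w.length = n ∧ IsAdmissibleList A w},
    ⨆ τ : cylListPlus A w.1, ENNReal.ofReal (Real.exp (birkPlus A ψ n τ.1))

/-- Topological pressure on the one-sided shift space. -/
noncomputable def pressurePlus (A : E → E → Bool) (ψ : EAplus A → ℝ) : EReal :=
  Filter.limsup (fun n : ℕ => (((n : ℝ)⁻¹ : ℝ) : EReal) * elog (partFnPlus A ψ n)) Filter.atTop

/-- The cylinder `[e] = {ω : ω₀ = e}`. -/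
def cylE (A : E → E → Bool) (e : E) : Set (EA A) := {τ | τ.1 0 = e}

/-- `ψ` is summable: `Σ_{e∈E} exp (sup ψ|_{[e]}) < +∞`. -/
def SummablePot (A : E → E → Bool) (ψ : EA A → ℝ) : Prop :=
  (∑' e : E, ⨆ τ : cylE A e, ENNReal.ofReal (Real.exp (ψ τ.1))) ≠ ⊤

/-- The cylinder `[ω|₀^{n-1}]`. -/
def cylOf (A : E → E → Bool) (ω : EA A) (n : ℕ) : Set (EA A) :=
  {τ | ∀ k : ℕ, k < n → τ.1 (k : ℤ) = ω.1 (k : ℤ)}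

/-- `μ` is a Gibbs state of `ψ`: it is a `σ`-invariant Borel probability measure and
there are `C ≥ 1`, `P ∈ ℝ` with
`C⁻¹ ≤ μ([ω|₀^{n-1}]) / exp (S_nψ(ω) - Pn) ≤ C` for all `n ≥ 1`, `ω ∈ E_A`. -/
def IsGibbs [MeasurableSpace E] (A : E → E → Bool) (ψ : EA A → ℝ)
    (μ : Measure (EA A)) : Prop :=
  IsProbabilityMeasure μ ∧ μ.map (shift A) = μ ∧
    ∃ C P : ℝ, 1 ≤ C ∧ ∀ n : ℕ, 1 ≤ n → ∀ ω : EA A,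
      ENNReal.ofReal (C⁻¹ * Real.exp (birk A ψ n ω - P * n)) ≤ μ (cylOf A ω n) ∧
      μ (cylOf A ω n) ≤ ENNReal.ofReal (C * Real.exp (birk A ψ n ω - P * n))

/-- A (global) system of conditional measures of `μ` with respect to the partition
of `E_A` into the fibers of `π₁ : E_A → E_A^+`. -/
def IsCondSystem [MeasurableSpace E] (A : E → E → Bool) (μ : Measure (EA A))
    (ν : EAplus A → Measure (EA A)) : Prop :=
  (∀ ω, IsProbabilityMeasure (ν ω)) ∧
  (∀ ω : EAplus A, ν ω {τ : EA A | proj1 A τ = ω} = 1) ∧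
  (∀ s : Set (EA A), MeasurableSet s → μ s = ∫⁻ ω, ν ω s ∂(μ.map (proj1 A)))

/-- The truncation `τ|_{-n}^{+∞}` of a two-sided sequence, as a one-sided sequence. -/
def tail (A : E → E → Bool) (τ : EA A) (n : ℕ) : EAplus A :=
  ⟨fun k => τ.1 ((k : ℤ) - (n : ℤ)), fun k => by
    have h := τ.2 ((k : ℤ) - (n : ℤ))
    have e : (((k + 1 : ℕ) : ℤ)) - (n : ℤ) = ((k : ℤ) - (n : ℤ)) + 1 := by push_cast; ring
    show A (τ.1 ((k : ℤ) - (n : ℤ))) (τ.1 (((k + 1 : ℕ) : ℤ) - (n : ℤ))) = true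
    rw [e]; exact h⟩

/-- The concatenation `eω` of a letter `e` with `ω ∈ E_A^+` (given `A e ω₀ = 1`). -/
def cons (A : E → E → Bool) (e : E) (ω : EAplus A) (h : A e (ω.1 0) = true) : EAplus A :=
  ⟨fun k => Nat.rec (motive := fun _ => E) e (fun m _ => ω.1 m) k, fun k => by
    cases k with
    | zero => exact h
    | succ m => exact ω.2 m⟩

variable {Y : Type*}

/-- `T_τ^n = T_{τ|_{-1}^{+∞}} ∘ T_{τ|_{-2}^{+∞}} ∘ … ∘ T_{τ|_{-n}^{+∞}}`. -/
def Tcomp (A : E → E → Bool) (T : EAplus A → Y → Y) (τ : EA A) : ℕ → Y → Y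
  | 0 => id
  | n + 1 => Tcomp A T τ n ∘ T (tail A τ (n + 1))

/-- `T_η^m = T_{σ^{m-1}η} ∘ … ∘ T_{ση} ∘ T_η` for `η ∈ E_A^+`. -/
def TcompPlus (A : E → E → Bool) (T : EAplus A → Y → Y) : EAplus A → ℕ → Y → Y
  | _, 0 => id
  | η, m + 1 => TcompPlus A T (shiftPlus A η) m ∘ T η



/-! ### Restricted pressure and past cylinders -/

/-- Partition function of `ψ` restricted to the subshift `F_A ⊆ E_A` over a finite
subalphabet `F`. -/
noncomputable def partFnF (A : E → E → Bool) (F : Finset E) (ψ : EA A → ℝ) (n : ℕ) : ℝ≥0∞ :=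
  ∑' w : {w : List E // w.length = n ∧ IsAdmissibleList A w ∧ ∀ e ∈ w, e ∈ F},
    ⨆ τ : ↥(cylList A w.1 ∩ {τ : EA A | ∀ k : ℤ, τ.1 k ∈ F}),
      ENNReal.ofReal (Real.exp (birk A ψ n τ.1))

/-- Topological pressure `P_F(ψ)` of `ψ|_{F_A}` with respect to the shift on the
subshift over the finite subalphabet `F` (equal to `⊥` if `F_A = ∅`). -/
noncomputable def pressureF (A : E → E → Bool) (F : Finset E) (ψ : EA A → ℝ) : EReal :=
  Filter.limsup (fun n : ℕ => (((n : ℝ)⁻¹ : ℝ) : EReal) * elog (partFnF A F ψ n)) Filter.atTop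

/-- The matrix `A` restricted to `F × F` is irreducible. -/
def IrredOn (A : E → E → Bool) (F : Finset E) : Prop :=
  ∀ a ∈ F, ∀ b ∈ F, ∃ w : List E, (∀ e ∈ w, e ∈ F) ∧ IsAdmissibleList A (a :: (w ++ [b]))

/-- The cylinder `[τω] ⊆ E_A`: sequences whose nonnegative part is `ω` and whose
coordinates `-n ≤ k ≤ -1` are given by the word `w` (with `w.get i` at coordinate
`i - n`, `n = |w|`). -/
def cylPast (A : E → E → Bool) (w : List E) (ω : EAplus A) : Set (EA A) :=
  {γ | proj1 A γ = ω ∧ ∀ k : Fin w.length, γ.1 (((k : ℕ) : ℤ) - (w.length : ℤ)) = w.get k}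

/-! ### Conformal skew product Smale endomorphisms -/

/-- A conformal skew product Smale endomorphism, i.e. a skew product Smale
endomorphism satisfying conditions (a)–(g) of Section 5 of the paper, with fibers
in `ℝ^d`. The projection `π̂₂` is part of the data, characterized by the field `hpi2`. -/
structure CSS [MeasurableSpace E] (A : E → E → Bool) (d : ℕ) where
  /-- The fiber sets `Y_ω`. -/
  Yset : EAplus A → Set (EuclideanSpace ℝ (Fin d))
  /-- The open neighborhoods `Y_ω^*` of the sets `Y_ω`. -/
  Ystar : EAplus A → Set (EuclideanSpace ℝ (Fin d))
  /-- The fiber maps `T_ω` (together with their conformal extensions to `Y_ω^*`). -/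
  T : EAplus A → EuclideanSpace ℝ (Fin d) → EuclideanSpace ℝ (Fin d)
  /-- The projection `π̂₂ : E_A → ℝ^d`. -/
  pi2 : EA A → EuclideanSpace ℝ (Fin d)
  lam : ℝ
  Hc : ℝ
  alpha : ℝ
  hlam : 1 < lam
  hHc : 0 < Hc
  halpha : 0 < alpha
  hYclosed : ∀ ω, IsClosed (Yset ω)
  hYbdd : Bornology.IsBounded (⋃ ω, Yset ω)
  hYreg : ∀ ω, Yset ω = closure (interior (Yset ω))
  hstar_open : ∀ ω, IsOpen (Ystar ω)
  hstar_conn : ∀ ω, IsConnected (Ystar ω)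
  hstar_bdd : ∀ ω, Bornology.IsBounded (Ystar ω)
  hYsub : ∀ ω, Yset ω ⊆ Ystar ω
  hmapsY : ∀ ω, Set.MapsTo (T ω) (Yset ω) (Yset (shiftPlus A ω))
  hmapsStar : ∀ ω, Set.MapsTo (T ω) (Ystar ω) (Ystar (shiftPlus A ω))
  hinj : ∀ ω, Set.InjOn (T ω) (Ystar ω)
  hC1 : ∀ ω, ContDiffOn ℝ 1 (T ω) (Ystar ω)
  hconf : ∀ ω, ∀ y ∈ Ystar ω, ConformalAt (T ω) y
  hcontr : ∀ ω, ∀ y ∈ Ystar ω, ∀ z ∈ Ystar ω, dist (T ω y) (T ω z) ≤ lam⁻¹ * dist y z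
  hdistort : ∀ ω, ∀ y ∈ Ystar ω, ∀ z ∈ Ystar ω,
      |Real.log ‖fderiv ℝ (T ω) y‖ - Real.log ‖fderiv ℝ (T ω) z‖| ≤ Hc * ‖y - z‖ ^ alpha
  hpi2 : ∀ τ : EA A,
      (⋂ n : ℕ, closure (Tcomp A T τ (n + 1) '' Yset (tail A τ (n + 1)))) = {pi2 τ}
  hHolderDer : ∃ β C : ℝ, 0 < β ∧ 0 < C ∧ ∀ τ τ' : EA A,
      |Real.log ‖fderiv ℝ (T (proj1 A τ)) (pi2 τ)‖ -
        Real.log ‖fderiv ℝ (T (proj1 A τ')) (pi2 τ')‖| ≤ C * dist2 A β τ τ'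
  hOSC : ∀ (ω : EAplus A) (a b : E) (ha : A a (ω.1 0) = true) (hb : A b (ω.1 0) = true),
      a ≠ b →
      Disjoint (T (cons A a ω ha) '' interior (Yset (cons A a ω ha)))
        (T (cons A b ω hb) '' interior (Yset (cons A b ω hb)))
  hbdry : ∃ δ : EAplus A → ℝ, Measurable δ ∧ (∀ ω, 0 < δ ω) ∧
      ∀ ω, ((pi2 '' {τ : EA A | proj1 A τ = ω}) ∩
        (Yset ω \ Metric.cthickening (δ ω) (Yset ω)ᶜ)).Nonempty

namespace CSS

variable [MeasurableSpace E] {d : ℕ}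

/-- The fiber `J_ω = π̂₂([ω])`. -/
def J (S : CSS A d) (ω : EAplus A) : Set (EuclideanSpace ℝ (Fin d)) :=
  S.pi2 '' {τ : EA A | proj1 A τ = ω}

/-- The system is Hölder: the projection `π̂` is Hölder continuous. -/
def IsHolder (S : CSS A d) : Prop :=
  ∃ κ C θ : ℝ, 0 < κ ∧ 0 < C ∧ 0 < θ ∧
    ∀ τ τ' : EA A, dist (S.pi2 τ) (S.pi2 τ') ≤ C * dist2 A κ τ τ' ^ θ

/-- Uniform Geometry Condition: every `Y_ω` contains a ball of a fixed radius `R > 0`. -/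
def UGC (S : CSS A d) : Prop :=
  ∃ R : ℝ, 0 < R ∧ ∀ ω : EAplus A, ∃ ξ, Metric.ball ξ R ⊆ S.Yset ω

/-- The geometric potential `ψ_t ∘ π̂ : τ ↦ -t log |T'_{τ|₀^{+∞}} (π̂₂ τ)|`. -/
noncomputable def geomPot (S : CSS A d) (t : ℝ) : EA A → ℝ :=
  fun τ => -t * Real.log ‖fderiv ℝ (S.T (proj1 A τ)) (S.pi2 τ)‖

/-- The pressure function `t ↦ P(t) = P(ψ_t ∘ π̂)`. -/
noncomputable def P (S : CSS A d) (t : ℝ) : EReal := pressure A (S.geomPot t)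

/-- Bowen's parameter `B_T = inf {t ≥ 0 : P(t) ≤ 0}` (equal to `⊤` if there is no
such `t`). -/
noncomputable def bowen (S : CSS A d) : ℝ≥0∞ :=
  sInf {s : ℝ≥0∞ | ∃ t : ℝ, 0 ≤ t ∧ s = ENNReal.ofReal t ∧ S.P t ≤ 0}

end CSS

/-- `φ_{ω|_n} = φ_{ω_0} ∘ φ_{ω_1} ∘ … ∘ φ_{ω_{n-1}}`. -/
def compPhi {Y : Type*} (A : E → E → Bool) (φ : E → Y → Y) (ω : EAplus A) : ℕ → Y → Y
  | 0 => id
  | n + 1 => compPhi A φ ω n ∘ φ (ω.1 n)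

/-- A conformal graph directed Markov system (GDMS) with vertex set `V`,
countable edge set `E`, and phase space in `ℝ^d`; the coding map `π_S` is part
of the data, characterized by the field `hpiS`. -/
structure GDMS (V : Type*) (E : Type*) (d : ℕ) where
  ivx : E → V
  tvx : E → V
  A : E → E → Bool
  hA : ∀ a b : E, A a b = true → tvx b = ivx a
  X : V → Set (EuclideanSpace ℝ (Fin d))
  W : V → Set (EuclideanSpace ℝ (Fin d))
  φ : E → EuclideanSpace ℝ (Fin d) → EuclideanSpace ℝ (Fin d)
  lam : ℝ
  hlam : lam ∈ Set.Ioo (0 : ℝ) 1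
  hXcpt : ∀ v, IsCompact (X v)
  hXconn : ∀ v, IsConnected (X v)
  hXreg : ∀ v, X v = closure (interior (X v))
  hWopen : ∀ v, IsOpen (W v)
  hWconn : ∀ v, IsConnected (W v)
  hXW : ∀ v, X v ⊆ W v
  hmapsX : ∀ e, Set.MapsTo (φ e) (X (tvx e)) (X (ivx e))
  hmapsW : ∀ e, Set.MapsTo (φ e) (W (tvx e)) (W (ivx e))
  hinj : ∀ e, Set.InjOn (φ e) (W (tvx e))
  hconf : ∀ e, ∀ y ∈ W (tvx e), ConformalAt (φ e) y
  hC1 : ∀ e, ContDiffOn ℝ 1 (φ e) (W (tvx e))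
  hLip : ∀ e, ∀ y ∈ X (tvx e), ∀ z ∈ X (tvx e), dist (φ e y) (φ e z) ≤ lam * dist y z
  piS : EAplus A → EuclideanSpace ℝ (Fin d)
  hpiS : ∀ ω : EAplus A, (⋂ n : ℕ, compPhi A φ ω (n + 1) '' X (tvx (ω.1 n))) = {piS ω}

/-! ### The Gauss map, continued fractions and the natural extension -/

/-- The Gauss (continued fraction) map `G(x) = 1/x - ⌊1/x⌋`, `G 0 = 0`. -/
noncomputable def gauss (x : ℝ) : ℝ := if x = 0 then 0 else Int.fract x⁻¹

/-- The denominators `q_n(x)` of the convergents of the continued fraction expansion,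
via `q₀ = 1`, `q₁ = ⌊1/x⌋` and `q_{n+2} = ⌊1/G^{n+1}(x)⌋ q_{n+1} + q_n`. -/
noncomputable def qden : ℕ → ℝ → ℤ
  | 0, _ => 1
  | 1, x => ⌊x⁻¹⌋
  | (n + 2), x => ⌊(gauss^[n + 1] x)⁻¹⌋ * qden (n + 1) x + qden n x

/-- `V_n(x) = q_{n-1}(x)/q_n(x)`, with `V₀ = 0`. -/
noncomputable def Vpast (n : ℕ) (x : ℝ) : ℝ :=
  if n = 0 then 0 else (qden (n - 1) x : ℝ) / (qden n x : ℝ)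

/-- The natural extension of the Gauss map, `Ĝ(x,y) = (G x, 1/(⌊1/x⌋ + y))`. -/
noncomputable def gaussExt (p : ℝ × ℝ) : ℝ × ℝ :=
  (gauss p.1, ((⌊p.1⁻¹⌋ : ℝ) + p.2)⁻¹)

/-! ### Words, cylinders and Birkhoff sums -/

theorem shift_iterate_apply (j : ℕ) (τ : EA A) (k : ℤ) :
    ((shift A)^[j] τ).1 k = τ.1 (k + j) := by
  induction j generalizing τ with
  | zero => simp
  | succ j ih =>
    rw [Function.iterate_succ_apply, ih]
    exact congrArg τ.1 (by push_cast; ring)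

theorem mem_cylList {w : List E} {τ : EA A} :
    τ ∈ cylList A w ↔ ∀ (k : ℕ) (hk : k < w.length), τ.1 (k : ℤ) = w[k] :=
  ⟨fun h k hk => h ⟨k, hk⟩, fun h k => h k.1 k.2⟩

theorem mem_cylList_append {u v : List E} {τ : EA A} (h : τ ∈ cylList A (u ++ v)) :
    τ ∈ cylList A u ∧ (shift A)^[u.length] τ ∈ cylList A v := by
  rw [mem_cylList] at h
  refine ⟨mem_cylList.2 fun k hk => ?_, mem_cylList.2 fun k hk => ?_⟩
  · rw [h k (by simp; omega), List.getElem_append_left hk]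
  · have := h (k + u.length) (by simp; omega)
    rw [shift_iterate_apply]
    rw [List.getElem_append_right (by omega)] at this
    simpa using this

theorem birk_add (ψ : EA A → ℝ) (m n : ℕ) (τ : EA A) :
    birk A ψ (m + n) τ = birk A ψ m τ + birk A ψ n ((shift A)^[m] τ) := by
  simp only [birk, Finset.sum_range_add]
  congr 1
  refine Finset.sum_congr rfl fun j _ => ?_
  rw [← Function.iterate_add_apply, add_comm]

/-- Bounded variation of the Birkhoff sums of a locally Hölder function on cylinders. -/
theorem LocallyHolderTwo.exists_variation_le {ψ : EA A → ℝ} (hψ : LocallyHolderTwo A ψ) :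
    ∃ K : ℝ, ∀ (w : List E), ∀ τ ∈ cylList A w, ∀ τ' ∈ cylList A w,
      birk A ψ w.length τ ≤ K + birk A ψ w.length τ' := by
  obtain ⟨β, C, hβ, hC, h⟩ := hψ
  set q := Real.exp (-β) with hq
  have hq0 : 0 ≤ q := (Real.exp_pos _).le
  have hq1 : q < 1 := by rw [hq, Real.exp_lt_one_iff]; linarith
  have hpow : ∀ j : ℕ, Real.exp (-β * j) = q ^ j := fun j => by
    rw [hq, ← Real.exp_nat_mul, mul_comm]
  have hgeom : ∀ n : ℕ, ∑ j ∈ Finset.range n, q ^ j ≤ (1 - q)⁻¹ := fun n => by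
    rw [← tsum_geometric_of_lt_one hq0 hq1]
    exact (summable_geometric_of_lt_one hq0 hq1).sum_le_tsum _ fun j _ => pow_nonneg hq0 j
  refine ⟨C * ((1 - q)⁻¹ + (1 - q)⁻¹), fun w τ hτ τ' hτ' => ?_⟩
  rw [mem_cylList] at hτ hτ'
  set n := w.length
  have hterm : ∀ j ∈ Finset.range n, ψ ((shift A)^[j] τ) ≤
      C * (q ^ j + q ^ (n - 1 - j)) + ψ ((shift A)^[j] τ') := by
    intro j hj
    have hj : j < n := Finset.mem_range.1 hj
    have hagree : agreeTwo ((shift A)^[j] τ) ((shift A)^[j] τ') (min j (n - 1 - j)) := by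
      intro k hk
      rw [abs_le] at hk
      obtain ⟨m, hm⟩ : ∃ m : ℕ, k + j = m := ⟨(k + j).toNat, by omega⟩
      have hmn : m < n := by omega
      rw [shift_iterate_apply, shift_iterate_apply, hm, hτ m hmn, hτ' m hmn]
    have h0 := hagree 0 (by simp)
    have h1 := (le_abs_self _).trans (h _ _ h0 _ hagree)
    have h2 : Real.exp (-β * (min j (n - 1 - j) : ℕ)) ≤ q ^ j + q ^ (n - 1 - j) := by
      rw [hpow]
      rcases min_choice j (n - 1 - j) with e | e <;> rw [e]
      · linarith [pow_nonneg hq0 (n - 1 - j)]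
      · linarith [pow_nonneg hq0 j]
    linarith [mul_le_mul_of_nonneg_left h2 hC.le]
  calc birk A ψ n τ ≤ ∑ j ∈ Finset.range n,
        (C * (q ^ j + q ^ (n - 1 - j)) + ψ ((shift A)^[j] τ')) := Finset.sum_le_sum hterm
    _ = C * (∑ j ∈ Finset.range n, q ^ j + ∑ j ∈ Finset.range n, q ^ j)
        + birk A ψ n τ' := by
      rw [Finset.sum_add_distrib, ← Finset.mul_sum, Finset.sum_add_distrib,
        Finset.sum_range_reflect (fun j => q ^ j) n, birk]
    _ ≤ _ := by gcongr <;> exact hgeom n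

theorem isAdmissibleList_of_mem_cylList {w : List E} {τ : EA A} (h : τ ∈ cylList A w) :
    IsAdmissibleList A w := by
  rw [mem_cylList] at h
  refine List.isChain_iff_getElem.2 fun i hi => ?_
  rw [← h i (by omega), ← h (i + 1) hi]
  exact_mod_cast τ.2 i

theorem IsAdmissibleList.append_link {u γ w : List E} (hu : IsAdmissibleList A u)
    (hw : IsAdmissibleList A w) (hu0 : u ≠ []) (hw0 : w ≠ [])
    (hγ : IsAdmissibleList A (u.getLast hu0 :: (γ ++ [w.head hw0]))) :
    IsAdmissibleList A (u ++ γ ++ w) := by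
  have h1 : IsAdmissibleList A (u.dropLast ++ [u.getLast hu0] ++ (γ ++ [w.head hw0])) :=
    List.IsChain.append_overlap (by rwa [List.dropLast_append_getLast]) hγ (by simp)
  rw [List.dropLast_append_getLast, ← List.append_assoc] at h1
  have h2 : IsAdmissibleList A (u ++ γ ++ [w.head hw0] ++ w.tail) :=
    List.IsChain.append_overlap h1 (by rwa [List.singleton_append, List.cons_head_tail]) (by simp)
  simpa using h2

theorem exists_forward_path {F : Set E} (hF : ∀ a ∈ F, ∃ b ∈ F, A a b = true)
    {a : E} (ha : a ∈ F) :
    ∃ x : ℕ → E, x 0 = a ∧ (∀ n, x n ∈ F) ∧ ∀ n, A (x n) (x (n + 1)) = true := by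
  choose! g hgF hg using hF
  have hmem : ∀ n, g^[n] a ∈ F := fun n => by
    induction n with
    | zero => exact ha
    | succ n ih => rw [Function.iterate_succ_apply']; exact hgF _ ih
  exact ⟨fun n => g^[n] a, rfl, hmem, fun n => by
    simp only [Function.iterate_succ_apply']; exact hg _ (hmem n)⟩

theorem exists_forward_path_extending {F : Set E} (hF : ∀ a ∈ F, ∃ b ∈ F, A a b = true)
    (u : List E) : ∀ a, IsAdmissibleList A (a :: u) → (∀ e ∈ a :: u, e ∈ F) →
    ∃ x : ℕ → E, (∀ n, x n ∈ F) ∧ (∀ n, A (x n) (x (n + 1)) = true) ∧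
      ∀ (k : ℕ) (hk : k < (a :: u).length), x k = (a :: u)[k] := by
  induction u with
  | nil =>
    intro a _ haF
    obtain ⟨x, hx0, hxF, hx⟩ := exists_forward_path hF (haF a (by simp))
    refine ⟨x, hxF, hx, fun k hk => ?_⟩
    obtain rfl : k = 0 := by simpa using hk
    simpa using hx0
  | cons b u ih =>
    intro a hadm haF
    obtain ⟨hab, hadm'⟩ := List.isChain_cons_cons.1 hadm
    obtain ⟨x, hxF, hx, hxu⟩ := ih b hadm' fun e he => haF e (List.mem_cons_of_mem _ he)
    refine ⟨fun n => Nat.casesOn n a x, fun n => ?_, fun n => ?_, fun k hk => ?_⟩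
    · cases n with
      | zero => exact haF a (by simp)
      | succ n => exact hxF n
    · cases n with
      | zero =>
        have h0 : x 0 = b := hxu 0 (by simp)
        simpa [h0] using hab
      | succ n => exact hx n
    · cases k with
      | zero => rfl
      | succ k => exact hxu k (by simpa using hk)

/-- If every letter of `F` has a successor and a predecessor in `F`, every nonempty admissible
word over `F` is realised by a bi-infinite sequence over `F`. -/
theorem exists_mem_cylList {F : Set E} (hsucc : ∀ a ∈ F, ∃ b ∈ F, A a b = true)
    (hpred : ∀ b ∈ F, ∃ a ∈ F, A a b = true) {u : List E} (hu0 : u ≠ [])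
    (hu : IsAdmissibleList A u) (huF : ∀ e ∈ u, e ∈ F) :
    ∃ τ : EA A, τ ∈ cylList A u ∧ ∀ k, τ.1 k ∈ F := by
  obtain ⟨a, u, rfl⟩ := List.exists_cons_of_ne_nil hu0
  obtain ⟨x, hxF, hx, hxu⟩ := exists_forward_path_extending hsucc u a hu huF
  obtain ⟨l, hl0, hlF, hl⟩ := exists_forward_path (A := fun c d => A d c) hpred (hxF 0)
  let y : ℤ → E
    | Int.ofNat n => x n
    | Int.negSucc n => l (n + 1)
  refine ⟨⟨y, fun n => ?_⟩, mem_cylList.2 fun k hk => hxu k hk, fun k => ?_⟩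
  · match n with
    | Int.ofNat n => exact hx n
    | Int.negSucc 0 =>
      have := hl 0
      rw [hl0] at this
      exact this
    | Int.negSucc (n + 1) => exact hl (n + 1)
  · match k with
    | Int.ofNat n => exact hxF n
    | Int.negSucc n => exact hlF (n + 1)

theorem exists_succ_of_link {a b : E} {γ : List E} (h : IsAdmissibleList A (a :: (γ ++ [b]))) :
    ∃ c, (c ∈ γ ∨ c = b) ∧ A a c = true := by
  cases γ with
  | nil => exact ⟨b, Or.inr rfl, (List.isChain_cons_cons.1 h).1⟩
  | cons c γ => exact ⟨c, by simp, (List.isChain_cons_cons.1 h).1⟩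

theorem exists_pred_of_link {a b : E} {γ : List E} (h : IsAdmissibleList A (a :: (γ ++ [b]))) :
    ∃ c, (c ∈ γ ∨ c = a) ∧ A c b = true := by
  rcases List.eq_nil_or_concat γ with rfl | ⟨γ, c, rfl⟩
  · exact ⟨a, Or.inr rfl, (List.isChain_cons_cons.1 h).1⟩
  · refine ⟨c, by simp, ?_⟩
    have h' : IsAdmissibleList A ((a :: γ) ++ [c, b]) := by simpa using h
    exact (List.isChain_cons_cons.1 (List.isChain_append.1 h').2.1).1

/-! ### Exponentials and logarithms in `ℝ≥0∞` -/

/-- The exponential `ℝ → ℝ≥0∞`. -/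
noncomputable def expE (x : ℝ) : ℝ≥0∞ := ENNReal.ofReal (Real.exp x)

theorem expE_add (x y : ℝ) : expE (x + y) = expE x * expE y := by
  rw [expE, Real.exp_add, ENNReal.ofReal_mul (Real.exp_pos x).le, expE, expE]

theorem expE_mono {x y : ℝ} (h : x ≤ y) : expE x ≤ expE y :=
  ENNReal.ofReal_le_ofReal (Real.exp_le_exp.2 h)

theorem expE_pos (x : ℝ) : 0 < expE x := ENNReal.ofReal_pos.2 (Real.exp_pos x)

theorem expE_ne_top (x : ℝ) : expE x ≠ ⊤ := ENNReal.ofReal_ne_top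

theorem expE_mul_nat (x : ℝ) (n : ℕ) : expE (x * n) = expE x ^ n := by
  rw [expE, expE, ← ENNReal.ofReal_pow (Real.exp_pos x).le, ← Real.exp_nat_mul, mul_comm]

theorem inv_mul_coe_log {n : ℕ} {z : ℝ≥0∞} (h0 : z ≠ 0) (ht : z ≠ ⊤) :
    (((n : ℝ)⁻¹ : ℝ) : EReal) * elog z = (((n : ℝ)⁻¹ * Real.log z.toReal : ℝ) : EReal) := by
  rw [elog, if_neg h0, if_neg ht, EReal.coe_mul]

theorem le_expE_of_inv_mul_elog_lt {n : ℕ} (hn : 0 < n) {z : ℝ≥0∞} {t : ℝ}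
    (h : (((n : ℝ)⁻¹ : ℝ) : EReal) * elog z < t) : z ≤ expE (t * n) := by
  have hn' : (0 : ℝ) < n := Nat.cast_pos.2 hn
  by_cases h0 : z = 0
  · simp [h0]
  by_cases ht : z = ⊤
  · rw [elog, if_neg h0, if_pos ht, EReal.coe_mul_top_of_pos (inv_pos.2 hn')] at h
    exact absurd h (not_lt_of_ge le_top)
  · rw [inv_mul_coe_log h0 ht, EReal.coe_lt_coe_iff, inv_mul_lt_iff₀ hn'] at h
    have hz := ENNReal.toReal_pos h0 ht
    rw [← ENNReal.ofReal_toReal ht, expE, ← Real.exp_log hz]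
    exact expE_mono (by linarith)

theorem expE_lt_of_lt_inv_mul_elog {n : ℕ} (hn : 0 < n) {z : ℝ≥0∞} {t : ℝ}
    (h : (t : EReal) < (((n : ℝ)⁻¹ : ℝ) : EReal) * elog z) : expE (t * n) < z := by
  have hn' : (0 : ℝ) < n := Nat.cast_pos.2 hn
  by_cases h0 : z = 0
  · rw [elog, if_pos h0, EReal.coe_mul_bot_of_pos (inv_pos.2 hn')] at h
    exact absurd h not_lt_bot
  by_cases ht : z = ⊤
  · rw [ht]; exact (expE_ne_top _).lt_top
  · rw [inv_mul_coe_log h0 ht, EReal.coe_lt_coe_iff, lt_inv_mul_iff₀ hn'] at h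
    have hz := ENNReal.toReal_pos h0 ht
    rw [← ENNReal.ofReal_toReal ht, expE, ENNReal.ofReal_lt_ofReal_iff hz,
      ← Real.lt_log_iff_exp_lt hz]
    linarith

theorem elog_mono {x y : ℝ≥0∞} (h : x ≤ y) : elog x ≤ elog y := by
  by_cases h0 : x = 0
  · simp [elog, h0]
  by_cases ht : y = ⊤
  · simp [elog, ht]
  have hx : x ≠ ⊤ := ne_top_of_le_ne_top ht h
  have hy : y ≠ 0 := (pos_iff_ne_zero.2 h0 |>.trans_le h).ne'
  rw [elog, elog, if_neg h0, if_neg hx, if_neg hy, if_neg ht, EReal.coe_le_coe_iff]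
  exact Real.log_le_log (ENNReal.toReal_pos h0 hx) (ENNReal.toReal_mono ht h)

theorem partFnF_le_partFn (F : Finset E) (ψ : EA A → ℝ) (n : ℕ) :
    partFnF A F ψ n ≤ partFn A ψ n := by
  let f : {w : List E // w.length = n ∧ IsAdmissibleList A w ∧ ∀ e ∈ w, e ∈ F} →
      {w : List E // w.length = n ∧ IsAdmissibleList A w} := fun w => ⟨w.1, w.2.1, w.2.2.1⟩
  have hf : Function.Injective f := fun u v h => Subtype.ext (congrArg (fun w => w.1) h)
  refine le_trans (ENNReal.tsum_le_tsum fun w => ?_) (ENNReal.tsum_comp_le_tsum_of_injective hf _)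
  exact iSup_le fun τ => le_iSup
    (fun τ : cylList A w.1 => ENNReal.ofReal (Real.exp (birk A ψ n τ.1))) ⟨τ.1, τ.2.1⟩

theorem pressureF_le_pressure (F : Finset E) (ψ : EA A → ℝ) :
    pressureF A F ψ ≤ pressure A ψ := by
  refine limsup_le_limsup (Eventually.of_forall fun n => ?_)
  exact mul_le_mul_of_nonneg_left (elog_mono (partFnF_le_partFn F ψ n))
    (EReal.coe_nonneg.2 (by positivity))

/-! ### Approximation by finite subsystems -/

/-- `e^{-t|u|}` times the supremum of `exp (S_{|u|}ψ)` over the part of the cylinder `[u]` lying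
in the subshift over `F`. -/
noncomputable def wordWeight (A : E → E → Bool) (F : Finset E) (ψ : EA A → ℝ) (t : ℝ)
    (u : List E) : ℝ≥0∞ :=
  expE (-t * u.length) * ⨆ τ : ↥(cylList A u ∩ {τ : EA A | ∀ k : ℤ, τ.1 k ∈ F}),
    expE (birk A ψ u.length τ.1)

theorem le_wordWeight {F : Finset E} {ψ : EA A → ℝ} {t : ℝ} {u : List E} {τ : EA A}
    (hτ : τ ∈ cylList A u) (hF : ∀ k, τ.1 k ∈ F) :
    expE (-t * u.length + birk A ψ u.length τ) ≤ wordWeight A F ψ t u := by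
  rw [expE_add, wordWeight]
  gcongr
  exact le_iSup (fun τ : ↥(cylList A u ∩ {τ : EA A | ∀ k : ℤ, τ.1 k ∈ F}) =>
    expE (birk A ψ u.length τ.1)) ⟨τ, hτ, hF⟩

theorem wordWeight_le {F : Finset E} {ψ : EA A → ℝ} {K t : ℝ}
    (hK : ∀ (w : List E), ∀ τ ∈ cylList A w, ∀ τ' ∈ cylList A w,
      birk A ψ w.length τ ≤ K + birk A ψ w.length τ') {u : List E} {τ : EA A}
    (hτ : τ ∈ cylList A u) :
    wordWeight A F ψ t u ≤ expE (-t * u.length + (K + birk A ψ u.length τ)) := by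
  rw [expE_add, wordWeight]
  gcongr
  exact iSup_le fun τ' => expE_mono (hK u _ τ'.2.1 _ hτ)

theorem wordWeight_mul_le {F : Finset E} {ψ : EA A → ℝ} {K B L t : ℝ}
    (hsucc : ∀ a ∈ F, ∃ b ∈ F, A a b = true) (hpred : ∀ b ∈ F, ∃ a ∈ F, A a b = true)
    (hK : ∀ (w : List E), ∀ τ ∈ cylList A w, ∀ τ' ∈ cylList A w,
      birk A ψ w.length τ ≤ K + birk A ψ w.length τ')
    {u γ w : List E} (hB : ∀ τ ∈ cylList A γ, -B ≤ birk A ψ γ.length τ) (hL : γ.length ≤ L)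
    (hu0 : u ≠ []) (hadm : IsAdmissibleList A (u ++ γ ++ w)) (hF : ∀ e ∈ u ++ γ ++ w, e ∈ F) :
    wordWeight A F ψ t u * wordWeight A F ψ t w * expE (-(2 * K + B + |t| * L)) ≤
      wordWeight A F ψ t (u ++ γ ++ w) := by
  obtain ⟨τ, hτ, hτF⟩ := exists_mem_cylList (F := (F : Set E)) hsucc hpred (by simp [hu0]) hadm hF
  refine le_trans ?_ (le_wordWeight hτ hτF)
  obtain ⟨huγ, hw⟩ := mem_cylList_append hτ
  obtain ⟨hu, hγ⟩ := mem_cylList_append huγ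
  refine (mul_le_mul_left (mul_le_mul' (wordWeight_le hK hu) (wordWeight_le hK hw)) _).trans ?_
  rw [← expE_add, ← expE_add]
  refine expE_mono ?_
  have hb : birk A ψ (u ++ γ ++ w).length τ = birk A ψ u.length τ +
      birk A ψ γ.length ((shift A)^[u.length] τ) +
      birk A ψ w.length ((shift A)^[(u ++ γ).length] τ) := by
    rw [List.length_append, birk_add, List.length_append, birk_add]
  have h1 := hB _ hγ
  have h2 : t * γ.length ≤ |t| * L :=
    (mul_le_mul_of_nonneg_right (le_abs_self t) (Nat.cast_nonneg _)).trans
      (mul_le_mul_of_nonneg_left hL (abs_nonneg t))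
  rw [hb]
  simp only [List.length_append, Nat.cast_add] at *
  nlinarith

/-- Admissible words over `F` of length at least `M`. -/
abbrev LongWord (A : E → E → Bool) (F : Finset E) (M : ℕ) : Type _ :=
  {u : List E // M ≤ u.length ∧ IsAdmissibleList A u ∧ ∀ e ∈ u, e ∈ F}

theorem tsum_wordWeight_le (F : Finset E) (ψ : EA A → ℝ) (t : ℝ) (M : ℕ) :
    ∑' u : LongWord A F M, wordWeight A F ψ t u.1 ≤
      ∑' m : {m : ℕ // M ≤ m}, expE (-t * m.1) * partFnF A F ψ m.1 := by
  let f : LongWord A F M → Σ m : {m : ℕ // M ≤ m},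
      {w : List E // w.length = m.1 ∧ IsAdmissibleList A w ∧ ∀ e ∈ w, e ∈ F} :=
    fun u => ⟨⟨u.1.length, u.2.1⟩, ⟨u.1, rfl, u.2.2⟩⟩
  have hf : Function.Injective f := fun u v h =>
    Subtype.ext (congrArg (fun p => p.2.1) h)
  calc _ ≤ ∑' p : Σ m : {m : ℕ // M ≤ m},
        {w : List E // w.length = m.1 ∧ IsAdmissibleList A w ∧ ∀ e ∈ w, e ∈ F},
        wordWeight A F ψ t p.2.1 :=
      ENNReal.tsum_comp_le_tsum_of_injective hf fun p => wordWeight A F ψ t p.2.1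
    _ = _ := by
      rw [ENNReal.tsum_sigma']
      refine tsum_congr fun m => ?_
      rw [partFnF, ← ENNReal.tsum_mul_left]
      refine tsum_congr fun w => ?_
      rw [wordWeight, w.2.1]
      rfl

theorem exists_tsum_wordWeight_ne_top {F : Finset E} {ψ : EA A → ℝ} {t : ℝ}
    (h : pressureF A F ψ < t) :
    ∃ M : ℕ, 0 < M ∧ ∑' u : LongWord A F M, wordWeight A F ψ t u.1 ≠ ⊤ := by
  obtain ⟨t', h1, h2⟩ := EReal.lt_iff_exists_real_btwn.1 h
  rw [EReal.coe_lt_coe_iff] at h2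
  obtain ⟨M, hM⟩ := eventually_atTop.1 (eventually_lt_of_limsup_lt h1)
  refine ⟨M + 1, M.succ_pos, ne_top_of_le_ne_top ?_ (tsum_wordWeight_le F ψ t (M + 1))⟩
  have hbound : ∀ m : {m : ℕ // M + 1 ≤ m},
      expE (-t * m.1) * partFnF A F ψ m.1 ≤ expE (t' - t) ^ m.1 := by
    rintro ⟨m, hm⟩
    have := le_expE_of_inv_mul_elog_lt (by omega) (hM m (by omega))
    calc _ ≤ expE (-t * m) * expE (t' * m) := by gcongr
      _ = _ := by rw [← expE_add, ← expE_mul_nat]; ring_nf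
  refine ne_top_of_le_ne_top ?_ ((ENNReal.tsum_le_tsum hbound).trans
    (ENNReal.tsum_comp_le_tsum_of_injective Subtype.val_injective fun m => expE (t' - t) ^ m))
  rw [ENNReal.tsum_geometric]
  refine ENNReal.inv_ne_top.2 (tsub_pos_of_lt ?_).ne'
  rw [expE, ENNReal.ofReal_lt_one, Real.exp_lt_one_iff]
  linarith

/-- If the pressure over `F` is below `t`, the total weight of a finite family of words of equal
length over `F` is at most the cost of linking words by elements of `Λ`. -/
theorem sum_wordWeight_mul_le {F : Finset E} {ψ : EA A → ℝ} {K B L t : ℝ} {Λ : Finset (List E)}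
    (hlink : ∀ a b : E, ∃ γ ∈ Λ, IsAdmissibleList A (a :: (γ ++ [b])))
    (hΛF : ∀ γ ∈ Λ, ∀ e ∈ γ, e ∈ F)
    (hsucc : ∀ a ∈ F, ∃ b ∈ F, A a b = true) (hpred : ∀ b ∈ F, ∃ a ∈ F, A a b = true)
    (hK : ∀ (w : List E), ∀ τ ∈ cylList A w, ∀ τ' ∈ cylList A w,
      birk A ψ w.length τ ≤ K + birk A ψ w.length τ')
    (hB : ∀ γ ∈ Λ, ∀ τ ∈ cylList A γ, -B ≤ birk A ψ γ.length τ)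
    (hL : ∀ γ ∈ Λ, (γ.length : ℝ) ≤ L) {n : ℕ} (hn : 0 < n)
    (s : Finset {w : List E // w.length = n ∧ IsAdmissibleList A w})
    (hsF : ∀ w ∈ s, ∀ e ∈ w.1, e ∈ F) (hF : F.Nonempty) (ht : pressureF A F ψ < t) :
    (∑ w ∈ s, wordWeight A F ψ t w.1) * expE (-(2 * K + B + |t| * L)) ≤ Λ.card := by
  obtain ⟨M, hM, hfin⟩ := exists_tsum_wordWeight_ne_top ht
  set G := ∑' u : LongWord A F M, wordWeight A F ψ t u.1
  have hpos : G ≠ 0 := by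
    obtain ⟨a, ha⟩ := hF
    obtain ⟨τ, -, hτF⟩ := exists_mem_cylList (F := (F : Set E)) hsucc hpred
      (List.cons_ne_nil a []) (List.isChain_singleton a) (by simpa using ha)
    have hτ : τ ∈ cylList A (List.ofFn fun i : Fin M => τ.1 (i : ℕ)) :=
      mem_cylList.2 fun k hk => by simp
    have hle := le_wordWeight (ψ := ψ) (t := t) hτ hτF
    let u : LongWord A F M := ⟨List.ofFn fun i : Fin M => τ.1 (i : ℕ), by simp,
      isAdmissibleList_of_mem_cylList hτ, fun e he => by
        obtain ⟨i, rfl⟩ := (List.mem_ofFn' _ _).1 he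
        exact hτF _⟩
    exact ((expE_pos _).trans_le (hle.trans
      (ENNReal.le_tsum (f := fun u : LongWord A F M => wordWeight A F ψ t u.1) u))).ne'
  choose g hgΛ hg using hlink
  have hu0 : ∀ u : LongWord A F M, u.1 ≠ [] := fun u h => by
    have := u.2.1
    simp [h] at this
    omega
  have hw0 : ∀ w : s, w.1.1 ≠ [] := fun w h => by
    have := w.1.2.1
    simp [h] at this
    omega
  let link : LongWord A F M × s → List E := fun p =>
    g (p.1.1.getLast (hu0 p.1)) (p.2.1.1.head (hw0 p.2))
  have hadm : ∀ p, IsAdmissibleList A (p.1.1 ++ link p ++ p.2.1.1) := fun p =>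
    p.1.2.2.1.append_link p.2.1.2.2 (hu0 p.1) (hw0 p.2) (hg _ _)
  have hmemF : ∀ p, ∀ e ∈ p.1.1 ++ link p ++ p.2.1.1, e ∈ F := fun p e he => by
    rcases List.mem_append.1 he with he | he
    · rcases List.mem_append.1 he with he | he
      · exact p.1.2.2.2 e he
      · exact hΛF _ (hgΛ _ _) e he
    · exact hsF _ p.2.2 e he
  let f : LongWord A F M × s → Λ × LongWord A F M := fun p =>
    (⟨link p, hgΛ _ _⟩, ⟨p.1.1 ++ link p ++ p.2.1.1, by
      simp only [List.length_append]; have := p.1.2.1; omega, hadm p, hmemF p⟩)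
  have hf : Function.Injective f := by
    intro p q hpq
    have h1 : link p = link q := congrArg (fun x => x.1.1) hpq
    have h2 : p.1.1 ++ link p ++ p.2.1.1 = q.1.1 ++ link q ++ q.2.1.1 :=
      congrArg (fun x => x.2.1) hpq
    obtain ⟨h3, h4⟩ := List.append_inj' h2 (p.2.1.2.1.trans q.2.1.2.1.symm)
    rw [h1] at h3
    exact Prod.ext (Subtype.ext (List.append_cancel_right h3)) (Subtype.ext (Subtype.ext h4))
  have key : G * ((∑ w ∈ s, wordWeight A F ψ t w.1) * expE (-(2 * K + B + |t| * L))) ≤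
      G * Λ.card := by
    calc _ = ∑' p : LongWord A F M × s, wordWeight A F ψ t p.1.1 * wordWeight A F ψ t p.2.1.1 *
          expE (-(2 * K + B + |t| * L)) := by
          rw [ENNReal.tsum_mul_right, ENNReal.tsum_prod', ← mul_assoc]
          simp_rw [ENNReal.tsum_mul_left]
          rw [ENNReal.tsum_mul_right, Finset.tsum_subtype s fun w => wordWeight A F ψ t w.1]
      _ ≤ ∑' p, wordWeight A F ψ t (f p).2.1 := ENNReal.tsum_le_tsum fun p =>
          wordWeight_mul_le hsucc hpred hK (hB _ (hgΛ _ _)) (hL _ (hgΛ _ _)) (hu0 p.1)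
            (hadm p) (hmemF p)
      _ ≤ ∑' q : Λ × LongWord A F M, wordWeight A F ψ t q.2.1 :=
          ENNReal.tsum_comp_le_tsum_of_injective hf fun q => wordWeight A F ψ t q.2.1
      _ = G * Λ.card := by
          rw [ENNReal.tsum_prod', tsum_fintype]
          dsimp only
          rw [Finset.sum_const, Finset.card_univ, Fintype.card_coe, nsmul_eq_mul, mul_comm]
  exact (ENNReal.mul_le_mul_iff_right hpos hfin).1 key

theorem pressure_le_iSup_irredOn (hA : FinitelyIrreducible A) {ψ : EA A → ℝ}
    (hψ : LocallyHolderTwo A ψ) :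
    pressure A ψ ≤ ⨆ F : {F : Finset E // IrredOn A F}, pressureF A F.1 ψ := by
  obtain ⟨Λ, -, hlink⟩ := hA
  obtain ⟨K, hK⟩ := hψ.exists_variation_le
  obtain ⟨B, hB⟩ : ∃ B : ℝ, ∀ γ ∈ Λ, ∀ τ ∈ cylList A γ, -B ≤ birk A ψ γ.length τ := by
    have : ∀ γ : List E, ∃ B : ℝ, ∀ τ ∈ cylList A γ, -B ≤ birk A ψ γ.length τ := fun γ => by
      rcases (cylList A γ).eq_empty_or_nonempty with h | ⟨τ₀, hτ₀⟩
      · exact ⟨0, by simp [h]⟩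
      · exact ⟨K - birk A ψ γ.length τ₀, fun τ hτ => by linarith [hK γ τ₀ hτ₀ τ hτ]⟩
    choose b hb using this
    obtain ⟨B, hB⟩ := (Λ.image b).bddAbove
    exact ⟨B, fun γ hγ τ hτ => (neg_le_neg (hB (Finset.mem_coe.2
      (Finset.mem_image_of_mem b hγ)))).trans (hb γ τ hτ)⟩
  obtain ⟨L, hL⟩ : ∃ L : ℝ, ∀ γ ∈ Λ, (γ.length : ℝ) ≤ L := by
    obtain ⟨L, hL⟩ := (Λ.image fun γ => (γ.length : ℝ)).bddAbove
    exact ⟨L, fun γ hγ => hL (Finset.mem_coe.2 (Finset.mem_image_of_mem _ hγ))⟩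
  by_contra! hlt
  obtain ⟨t, ht, hlt⟩ := EReal.lt_iff_exists_real_btwn.1 hlt
  obtain ⟨s, hts, hs⟩ := EReal.lt_iff_exists_real_btwn.1 hlt
  rw [EReal.coe_lt_coe_iff] at hts
  have hlarge : ∀ᶠ n : ℕ in atTop,
      (Λ.card : ℝ) < Real.exp ((s - t) * n + -(K + (2 * K + B + |t| * L))) :=
    (Real.tendsto_exp_atTop.comp (tendsto_atTop_add_const_right _ _
      (tendsto_natCast_atTop_atTop.const_mul_atTop (sub_pos.2 hts)))).eventually_gt_atTop _
  obtain ⟨n, hn, hcard, hn0⟩ := ((frequently_lt_of_lt_limsup (by isBoundedDefault) hs).and_eventually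
    (hlarge.and (eventually_gt_atTop 0))).exists
  have hZ := expE_lt_of_lt_inv_mul_elog hn0 hn
  rw [partFn, ENNReal.tsum_eq_iSup_sum, lt_iSup_iff] at hZ
  obtain ⟨W, hW⟩ := hZ
  set F : Finset E := Λ.biUnion List.toFinset ∪ W.biUnion fun w => w.1.toFinset
  have hΛF : ∀ γ ∈ Λ, ∀ e ∈ γ, e ∈ F := fun γ hγ e he =>
    Finset.mem_union_left _ (Finset.mem_biUnion.2 ⟨γ, hγ, List.mem_toFinset.2 he⟩)
  have hWF : ∀ w ∈ W, ∀ e ∈ w.1, e ∈ F := fun w hw e he =>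
    Finset.mem_union_right _ (Finset.mem_biUnion.2 ⟨w, hw, List.mem_toFinset.2 he⟩)
  have hirr : IrredOn A F := fun a _ b _ => by
    obtain ⟨γ, hγ, h⟩ := hlink a b
    exact ⟨γ, hΛF γ hγ, h⟩
  have hsucc : ∀ a ∈ F, ∃ b ∈ F, A a b = true := fun a ha => by
    obtain ⟨γ, hγ, h⟩ := hlink a a
    obtain ⟨c, hc | rfl, h⟩ := exists_succ_of_link h
    exacts [⟨c, hΛF γ hγ c hc, h⟩, ⟨c, ha, h⟩]
  have hpred : ∀ b ∈ F, ∃ a ∈ F, A a b = true := fun a ha => by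
    obtain ⟨γ, hγ, h⟩ := hlink a a
    obtain ⟨c, hc | rfl, h⟩ := exists_pred_of_link h
    exacts [⟨c, hΛF γ hγ c hc, h⟩, ⟨c, ha, h⟩]
  have hne : ∀ w : {w : List E // w.length = n ∧ IsAdmissibleList A w}, w.1 ≠ [] := fun w h => by
    have := w.2.1
    simp [h] at this
    omega
  have hFne : F.Nonempty := by
    obtain ⟨w, hw⟩ : W.Nonempty := by
      rw [Finset.nonempty_iff_ne_empty]
      rintro rfl
      simp at hW
    exact ⟨_, hWF w hw _ (List.head_mem (hne w))⟩
  have htF : pressureF A F ψ < t :=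
    (le_iSup (fun F : {F : Finset E // IrredOn A F} => pressureF A F.1 ψ) ⟨F, hirr⟩).trans_lt ht
  have hle := sum_wordWeight_mul_le hlink hΛF hsucc hpred hK hB hL hn0 W hWF hFne htF
  have hsum : expE (-t * n + -K) * expE (s * n) ≤ ∑ w ∈ W, wordWeight A F ψ t w.1 := by
    refine (mul_le_mul_right hW.le _).trans ?_
    rw [Finset.mul_sum]
    refine Finset.sum_le_sum fun w hw => ?_
    obtain ⟨τ, hτ, hτF⟩ := exists_mem_cylList (F := (F : Set E)) hsucc hpred (hne w) w.2.2 (hWF w hw)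
    refine le_trans ?_ (le_wordWeight hτ hτF)
    have hsup : ⨆ τ : cylList A w.1, ENNReal.ofReal (Real.exp (birk A ψ n τ.1)) ≤
        expE (K + birk A ψ n τ) := iSup_le fun τ' => expE_mono <| by
      have := hK w.1 τ'.1 τ'.2 τ hτ
      rwa [w.2.1] at this
    refine (mul_le_mul_right hsup _).trans ?_
    rw [← expE_add, w.2.1]
    exact expE_mono (by linarith)
  have hfinal := (mul_le_mul_left hsum _).trans hle
  rw [← expE_add, ← expE_add, expE, ← ENNReal.ofReal_natCast,
    ENNReal.ofReal_le_ofReal_iff (Nat.cast_nonneg _)] at hfinal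
  refine absurd (hcard.trans_le (le_of_eq ?_)) hfinal.not_gt
  congr 1
  ring

/-- `P(ψ) = sup {P_F(ψ) : F ⊆ E finite}`, and the supremum is also
attained over the finite subsets `F` with `A|_{F×F}` irreducible. -/
theorem statement2 [Countable E] {A : E → E → Bool} (hA : FinitelyIrreducible A)
    (ψ : EA A → ℝ) (hψ : LocallyHolderTwo A ψ) :
    (pressure A ψ = ⨆ F : Finset E, pressureF A F ψ) ∧
    (pressure A ψ = ⨆ F : {F : Finset E // IrredOn A F}, pressureF A F.1 ψ) := by
  have h1 := pressure_le_iSup_irredOn hA hψ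
  have h2 : ⨆ F : {F : Finset E // IrredOn A F}, pressureF A F.1 ψ ≤
      ⨆ F : Finset E, pressureF A F ψ :=
    iSup_le fun F => le_iSup (fun F : Finset E => pressureF A F ψ) F.1
  have h3 : ⨆ F : Finset E, pressureF A F ψ ≤ pressure A ψ :=
    iSup_le fun F => pressureF_le_pressure F ψ
  exact ⟨le_antisymm (h1.trans h2) h3, le_antisymm h1 (h2.trans h3)⟩

end Paper
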